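/- arXiv:2301.00543 — 3 statements merged into one kernel-verified Lean document; each statement's English description precedes it below -/
import Mathlib

section
/- For each fixed n ≥ 3, any two subgroups of PGL₃(ℂ) isomorphic to the dihedral group of order 2n are conjugate in PGL₃(ℂ); in particular each such subgroup is conjugate to the group generated by the images of [X:Z:Y] and diag(1, ζₙ, ζₙ⁻¹). -/
open Matrix

noncomputable section

abbrev PGL3C := GL (Fin 3) ℂ ⧸ Subgroup.center (GL (Fin 3) ℂ)

def proj : GL (Fin 3) ℂ →* PGL3C := QuotientGroup.mk' _

def sigmaGL : GL (Fin 3) ℂ ≃* GL (Fin 3) ℂ :=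
  Units.mapEquiv (Complex.conjAe.toRingEquiv.mapMatrix.toMulEquiv)

lemma sigma_center :
    (Subgroup.center (GL (Fin 3) ℂ)).map sigmaGL.toMonoidHom
      = Subgroup.center (GL (Fin 3) ℂ) := by
  ext x
  simp only [Subgroup.mem_map, Subgroup.mem_center_iff]
  constructor
  · rintro ⟨y, hy, rfl⟩ g
    have := hy (sigmaGL.symm g)
    calc g * sigmaGL y = sigmaGL (sigmaGL.symm g * y) := by
          simp [_root_.map_mul]
      _ = sigmaGL (y * sigmaGL.symm g) := by rw [this]
      _ = sigmaGL y * g := by simp [_root_.map_mul]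
  · intro hx
    refine ⟨sigmaGL.symm x, fun g => ?_, by simp⟩
    have := hx (sigmaGL g)
    calc g * sigmaGL.symm x = sigmaGL.symm (sigmaGL g * x) := by simp [_root_.map_mul]
      _ = sigmaGL.symm (x * sigmaGL g) := by rw [this]
      _ = sigmaGL.symm x * g := by simp [_root_.map_mul]

def sigmaPGL : PGL3C ≃* PGL3C :=
  QuotientGroup.congr _ _ sigmaGL sigma_center

def PGL3R : Subgroup PGL3C :=
  ((Units.map ((algebraMap ℝ ℂ).mapMatrix.toMonoidHom :
      Matrix (Fin 3) (Fin 3) ℝ →* Matrix (Fin 3) (Fin 3) ℂ)).range).map proj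

lemma exists_eigenvalue_sq_ne_one {n : ℕ} (hn : n ≠ 0) {A : Matrix (Fin 3) (Fin 3) ℂ} {c : ℂ}
    (hc : c ≠ 0) (hA : A ^ n = c • 1) (hA2 : A ^ 2 ≠ 1) :
    ∃ μ : ℂ, μ ^ 2 ≠ 1 ∧ ∃ w : Fin 3 → ℂ, w ≠ 0 ∧ A *ᵥ w = μ • w := by
  by_contra! h
  have hss : Module.End.IsSemisimple (Matrix.toLin' A) := by
    refine Module.End.isSemisimple_of_squarefree_aeval_eq_zero
      (p := Polynomial.X ^ n - Polynomial.C c)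
      (Polynomial.separable_X_pow_sub_C c (by exact_mod_cast hn) hc).squarefree ?_
    simp only [map_sub, map_pow, Polynomial.aeval_X, Polynomial.aeval_C]
    rw [← Matrix.toLin'_pow, hA, map_smul, Matrix.toLin'_one, Algebra.algebraMap_eq_smul_one,
      Module.End.one_eq_id, sub_self]
  have htop := hss.iSup_eigenspace_eq_top
  have hker : (⊤ : Submodule ℂ (Fin 3 → ℂ)) ≤ LinearMap.ker (Matrix.toLin' (A ^ 2 - 1)) := by
    rw [← htop]
    refine iSup_le fun μ w hw => ?_
    rw [Module.End.mem_eigenspace_iff, Matrix.toLin'_apply] at hw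
    by_cases hw0 : w = 0
    · simp [hw0]
    have hμ : μ ^ 2 = 1 := by
      by_contra hne
      exact h μ hne w hw0 hw
    rw [LinearMap.mem_ker, Matrix.toLin'_apply, Matrix.sub_mulVec, pow_two, ← Matrix.mulVec_mulVec,
      hw, Matrix.mulVec_smul, hw, smul_smul, ← pow_two, hμ]
    simp
  refine hA2 (sub_eq_zero.1 (Matrix.toLin'.injective ?_))
  rw [map_zero]
  exact LinearMap.ker_eq_top.1 (top_le_iff.1 hker)

lemma exists_fixed_vector {A B : Matrix (Fin 3) (Fin 3) ℂ} (hAB : A * B * A = B)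
    (hB : B * B = 1) (hdet : A.det = 1) : ∃ v : Fin 3 → ℂ, v ≠ 0 ∧ A *ᵥ v = v := by
  have hBdet : B.det ≠ 0 := fun h => by
    have := congrArg Matrix.det hB
    simp [h] at this
  have key : A * B * (A - 1) = -((A - 1) * B) := by
    rw [mul_sub, hAB]
    noncomm_ring
  have h := congrArg Matrix.det key
  rw [Matrix.det_neg, Matrix.det_mul, Matrix.det_mul, Matrix.det_mul, hdet, Fintype.card_fin] at h
  have h0 : (A - 1).det = 0 := by
    have : (2 * B.det) * (A - 1).det = 0 := by linear_combination h
    simpa [hBdet] using this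
  obtain ⟨v, hv, hv'⟩ := Matrix.exists_mulVec_eq_zero_iff.2 h0
  refine ⟨v, hv, ?_⟩
  rwa [Matrix.sub_mulVec, Matrix.one_mulVec, sub_eq_zero] at hv'

/-- A pair of matrices satisfying the dihedral relations is simultaneously conjugate, up to a sign,
to the standard pair. -/
lemma exists_dihedral_normal_form {n : ℕ} (hn : n ≠ 0) {A B : Matrix (Fin 3) (Fin 3) ℂ} {c : ℂ}
    (hc : c ≠ 0) (hA : A ^ n = c • 1) (hA2 : A ^ 2 ≠ 1) (hAB : A * B * A = B)
    (hB : B * B = 1) (hdet : A.det = 1) :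
    ∃ (μ ε : ℂ) (P : Matrix (Fin 3) (Fin 3) ℂ), IsUnit P ∧ ε ≠ 0 ∧
      A * P = P * Matrix.diagonal ![1, μ, μ⁻¹] ∧
      B * P = ε • (P * !![1, 0, 0; 0, 0, 1; 0, 1, 0]) := by
  obtain ⟨v, hv, hAv⟩ := exists_fixed_vector hAB hB hdet
  obtain ⟨μ, hμ, w, hw, hAw⟩ := exists_eigenvalue_sq_ne_one hn hc hA hA2
  have hBB : ∀ x : Fin 3 → ℂ, B *ᵥ (B *ᵥ x) = x := fun x => by
    rw [Matrix.mulVec_mulVec, hB, Matrix.one_mulVec]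
  have hABA : ∀ x : Fin 3 → ℂ, A *ᵥ (B *ᵥ (A *ᵥ x)) = B *ᵥ x := fun x => by
    rw [Matrix.mulVec_mulVec, Matrix.mulVec_mulVec, hAB]
  have hμ0 : μ ≠ 0 := by
    rintro rfl
    have h1 := hABA w
    rw [hAw, zero_smul, Matrix.mulVec_zero, Matrix.mulVec_zero] at h1
    exact hw (by rw [← hBB w, ← h1, Matrix.mulVec_zero])
  have hBw0 : B *ᵥ w ≠ 0 := fun h => hw (by rw [← hBB w, h, Matrix.mulVec_zero])
  have hABw : A *ᵥ (B *ᵥ w) = μ⁻¹ • (B *ᵥ w) := by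
    have h1 := hABA w
    rw [hAw, Matrix.mulVec_smul, Matrix.mulVec_smul] at h1
    rw [← h1, smul_smul, inv_mul_cancel₀ hμ0, one_smul, h1]
  have hABv : A *ᵥ (B *ᵥ v) = B *ᵥ v := by
    have h1 := hABA v
    rwa [hAv] at h1
  have hμ1 : μ ≠ 1 := by rintro rfl; simp at hμ
  have hμi : μ⁻¹ ≠ 1 := by simpa using hμ1
  have hμμ : μ ≠ μ⁻¹ := fun h => hμ (by
    rw [pow_two]
    nth_rewrite 2 [h]
    exact mul_inv_cancel₀ hμ0)
  set b : Fin 3 → Fin 3 → ℂ := ![v, w, B *ᵥ w] with hb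
  have hli : LinearIndependent ℂ b := by
    refine Module.End.eigenvectors_linearIndependent' (Matrix.toLin' A) ![1, μ, μ⁻¹] ?_ b ?_
    · intro i j hij
      fin_cases i <;> fin_cases j <;>
        first
          | rfl
          | exact absurd hij hμ1
          | exact absurd hij hμi
          | exact absurd hij hμμ
          | exact absurd hij.symm hμ1
          | exact absurd hij.symm hμi
          | exact absurd hij.symm hμμ
    · intro i
      rw [Module.End.hasEigenvector_iff, Module.End.mem_eigenspace_iff, Matrix.toLin'_apply]
      fin_cases i <;> simp [hb, hv, hw, hBw0, hAv, hAw, hABw]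
  set P : Matrix (Fin 3) (Fin 3) ℂ := (Matrix.of b)ᵀ with hP
  have hPu : IsUnit P := by
    rw [← Matrix.linearIndependent_cols_iff_isUnit]
    exact hli
  have mul_col : ∀ (M : Matrix (Fin 3) (Fin 3) ℂ) i j, (M * P) i j = (M *ᵥ b j) i := fun M i j => rfl
  have hAP : A * P = P * Matrix.diagonal ![1, μ, μ⁻¹] := by
    ext i j
    rw [mul_col, Matrix.mul_diagonal]
    fin_cases j <;> simp [hb, hP, hAv, hAw, hABw, mul_comm]
  -- the fixed space of `A` is the line spanned by `v`
  obtain ⟨ε, hε⟩ : ∃ ε : ℂ, B *ᵥ v = ε • v := by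
    obtain ⟨Q, hPQ⟩ := hPu.exists_right_inv
    have hQP : Q * P = 1 := mul_eq_one_comm.1 hPQ
    set x := Q *ᵥ (B *ᵥ v) with hx
    have hPx : P *ᵥ x = B *ᵥ v := by rw [hx, Matrix.mulVec_mulVec, hPQ, Matrix.one_mulVec]
    have hDx : Matrix.diagonal ![1, μ, μ⁻¹] *ᵥ x = x := by
      have h1 : (A * P) *ᵥ x = P *ᵥ x := by rw [← Matrix.mulVec_mulVec, hPx, hABv]
      rw [hAP, ← Matrix.mulVec_mulVec] at h1
      have h2 := congrArg (Q *ᵥ ·) h1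
      simpa only [Matrix.mulVec_mulVec, hQP, Matrix.one_mulVec, ← mul_assoc, one_mul] using h2
    have hx1 : x 1 = 0 := by
      have h1 := congrFun hDx 1
      rw [Matrix.mulVec_diagonal] at h1
      by_contra h
      exact hμ1 ((mul_eq_right₀ h).1 h1)
    have hx2 : x 2 = 0 := by
      have h1 := congrFun hDx 2
      rw [Matrix.mulVec_diagonal] at h1
      by_contra h
      exact hμi ((mul_eq_right₀ h).1 h1)
    refine ⟨x 0, ?_⟩
    rw [← hPx]
    ext i
    simp [Matrix.mulVec, dotProduct, Fin.sum_univ_three, hx1, hx2, hP, hb, mul_comm]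
  have hε2 : ε * ε = 1 := by
    have h1 := hBB v
    rw [hε, Matrix.mulVec_smul, hε, smul_smul] at h1
    exact smul_left_injective ℂ hv (by simpa using h1)
  have hε0 : ε ≠ 0 := by rintro rfl; simp at hε2
  -- rescaling the third eigenvector absorbs the sign
  have hBP : B * P = P * !![ε, 0, 0; 0, 0, 1; 0, 1, 0] := by
    ext i j
    rw [mul_col]
    fin_cases j <;> simp [hb, hP, hε, hBB, Matrix.mul_apply, Fin.sum_univ_three, mul_comm]
  refine ⟨μ, ε, P * Matrix.diagonal ![1, 1, ε], hPu.mul ?_, hε0, ?_, ?_⟩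
  · rw [Matrix.isUnit_iff_isUnit_det, Matrix.det_diagonal, Fin.prod_univ_three]
    simpa using hε0
  · rw [← mul_assoc, hAP, mul_assoc, mul_assoc, Matrix.diagonal_mul_diagonal,
      Matrix.diagonal_mul_diagonal]
    simp only [mul_comm]
  · rw [← mul_assoc, hBP, mul_assoc, mul_assoc, ← Matrix.mul_smul]
    congr 1
    ext i j
    rw [Matrix.mul_diagonal, Matrix.smul_apply, Matrix.diagonal_mul]
    fin_cases i <;> fin_cases j <;> simp [hε2]

lemma proj_eq_proj_iff {x y : GL (Fin 3) ℂ} :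
    proj x = proj y ↔ ∃ u : ℂˣ, x = GeneralLinearGroup.scalar (Fin 3) u * y := by
  rw [eq_comm]
  refine (QuotientGroup.eq (s := Subgroup.center (GL (Fin 3) ℂ))).trans ?_
  rw [GeneralLinearGroup.center_eq_range_scalar, MonoidHom.mem_range]
  refine exists_congr fun u => ?_
  rw [GeneralLinearGroup.scalar_commute, eq_inv_mul_iff_mul_eq, eq_comm]

lemma proj_scalar_mul (u : ℂˣ) (x : GL (Fin 3) ℂ) :
    proj (GeneralLinearGroup.scalar (Fin 3) u * x) = proj x :=
  proj_eq_proj_iff.2 ⟨u, rfl⟩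

lemma proj_surjective : Function.Surjective proj := QuotientGroup.mk'_surjective _

lemma exists_units_sq_eq (u : ℂˣ) : ∃ d : ℂˣ, d * d = u := by
  obtain ⟨z, hz⟩ := IsAlgClosed.exists_pow_nat_eq (u : ℂ) two_pos
  rw [pow_two] at hz
  have hz0 : z ≠ 0 := by
    rintro rfl
    exact u.ne_zero (by simpa using hz.symm)
  exact ⟨Units.mk0 z hz0, Units.ext hz⟩

/-- The dihedral relations in the projective group lift to the linear group. -/
lemma exists_lift_dihedral {a b : PGL3C} (hab : a * b * a = b) (hb : b * b = 1) :
    ∃ A B : GL (Fin 3) ℂ, proj A = a ∧ proj B = b ∧ A * B * A = B ∧ B * B = 1 ∧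
      GeneralLinearGroup.det A = 1 := by
  have rescale : ∀ (u : ℂˣ) (X Y : GL (Fin 3) ℂ),
      GeneralLinearGroup.scalar (Fin 3) u * X * Y * (GeneralLinearGroup.scalar (Fin 3) u * X) =
        GeneralLinearGroup.scalar (Fin 3) (u * u) * (X * Y * X) := fun u X Y => by
    rw [map_mul, ← mul_assoc, ← GeneralLinearGroup.scalar_commute]
    simp only [mul_assoc]
  obtain ⟨A₀, rfl⟩ := proj_surjective a
  obtain ⟨B₀, rfl⟩ := proj_surjective b
  obtain ⟨c, hc⟩ := proj_eq_proj_iff.1 ((map_mul proj _ _).trans ((congrArg (· * proj A₀)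
    (map_mul proj A₀ B₀)).trans hab))
  obtain ⟨e, he⟩ := proj_eq_proj_iff.1 ((map_mul proj _ _).trans (hb.trans (map_one proj).symm))
  obtain ⟨d, hd⟩ := exists_units_sq_eq c⁻¹
  obtain ⟨f, hf⟩ := exists_units_sq_eq e⁻¹
  set A₁ := GeneralLinearGroup.scalar (Fin 3) d * A₀ with hA₁
  set B := GeneralLinearGroup.scalar (Fin 3) f * B₀ with hBdef
  have hA₁B₀ : A₁ * B₀ * A₁ = B₀ := by
    rw [hA₁, rescale, hd, hc, ← mul_assoc, ← map_mul, inv_mul_cancel, map_one, one_mul]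
  have hB : B * B = 1 := by
    have := rescale f B₀ 1
    rwa [mul_one (_ * B₀), mul_one B₀, hf, he, mul_one, ← map_mul, inv_mul_cancel, map_one] at this
  have hA₁B : A₁ * B * A₁ = B := by
    rw [hBdef, ← mul_assoc A₁, ← GeneralLinearGroup.scalar_commute, mul_assoc _ A₁ B₀,
      mul_assoc _ (A₁ * B₀), hA₁B₀]
  have hdet : GeneralLinearGroup.det A₁ * GeneralLinearGroup.det A₁ = 1 := by
    have h := congrArg GeneralLinearGroup.det hA₁B₀
    rw [map_mul, map_mul, mul_right_comm] at h
    exact mul_eq_right.1 h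
  refine ⟨GeneralLinearGroup.scalar (Fin 3) (GeneralLinearGroup.det A₁) * A₁, B,
    ?_, proj_scalar_mul _ _, ?_, hB, ?_⟩
  · rw [proj_scalar_mul, hA₁, proj_scalar_mul]
  · rw [rescale, hdet, map_one, one_mul, hA₁B]
  · rw [map_mul, GeneralLinearGroup.det_scalar, Fintype.card_fin, pow_succ, pow_two, hdet, one_mul,
      hdet]

lemma isPrimitiveRoot_orderOf_proj {D : GL (Fin 3) ℂ} {μ : ℂ}
    (hD : (D : Matrix (Fin 3) (Fin 3) ℂ) = Matrix.diagonal ![1, μ, μ⁻¹]) :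
    IsPrimitiveRoot μ (orderOf (proj D)) := by
  have hpow : ∀ k : ℕ, ((D ^ k : GL (Fin 3) ℂ) : Matrix (Fin 3) (Fin 3) ℂ) =
      Matrix.diagonal (![1, μ, μ⁻¹] ^ k) := fun k => by
    rw [Units.val_pow_eq_pow_val, hD, Matrix.diagonal_pow]
  constructor
  · have h : proj (D ^ orderOf (proj D)) = proj 1 := by
      rw [map_pow, pow_orderOf_eq_one, map_one]
    obtain ⟨u, hu⟩ := proj_eq_proj_iff.1 h
    have h2 := (hpow _).symm.trans (congrArg Units.val hu)
    rw [mul_one, GeneralLinearGroup.coe_scalar] at h2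
    have h00 := congrFun (congrFun h2 0) 0
    have h11 := congrFun (congrFun h2 1) 1
    simp only [Matrix.scalar_apply, Matrix.diagonal_apply_eq, Pi.pow_apply] at h00 h11
    simpa [← h00] using h11
  · intro k hk
    apply orderOf_dvd_of_pow_eq_one
    rw [← map_pow]
    have : D ^ k = 1 := by
      apply Units.ext
      rw [hpow, Units.val_one, ← Matrix.diagonal_one]
      congr 1
      ext i
      fin_cases i <;> simp [hk]
    rw [this, map_one]

lemma exists_conj_eq_standard {a b : PGL3C} (ha : 3 ≤ orderOf a) (hab : a * b * a = b)
    (hb : b * b = 1) {S : GL (Fin 3) ℂ}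
    (hS : (S : Matrix (Fin 3) (Fin 3) ℂ) = !![1, 0, 0; 0, 0, 1; 0, 1, 0]) :
    ∃ (φ : PGL3C) (D : GL (Fin 3) ℂ) (μ : ℂ),
      (D : Matrix (Fin 3) (Fin 3) ℂ) = Matrix.diagonal ![1, μ, μ⁻¹] ∧
      φ * a * φ⁻¹ = proj D ∧ φ * b * φ⁻¹ = proj S := by
  obtain ⟨A, B, rfl, rfl, hAB, hB, hdet⟩ := exists_lift_dihedral hab hb
  have hAn : proj (A ^ orderOf (proj A)) = proj 1 := by
    rw [map_pow, pow_orderOf_eq_one, map_one]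
  obtain ⟨c, hc⟩ := proj_eq_proj_iff.1 hAn
  have hA2 : (A : Matrix (Fin 3) (Fin 3) ℂ) ^ 2 ≠ 1 := fun h => by
    have h2 : A ^ 2 = 1 := Units.ext (by rw [Units.val_pow_eq_pow_val, h, Units.val_one])
    have := orderOf_le_of_pow_eq_one two_pos (by rw [← map_pow, h2, map_one] : proj A ^ 2 = 1)
    omega
  obtain ⟨μ, ε, P, ⟨P, rfl⟩, hε, hAP, hBP⟩ := exists_dihedral_normal_form
    (n := orderOf (proj A)) (by omega) (A := A) (B := B) c.ne_zero
    (by rw [← Units.val_pow_eq_pow_val, hc, mul_one, GeneralLinearGroup.coe_scalar,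
          Matrix.scalar_apply, Matrix.smul_one_eq_diagonal]) hA2
    (congrArg Units.val hAB) (congrArg Units.val hB) (congrArg Units.val hdet)
  refine ⟨proj P⁻¹, P⁻¹ * A * P, μ, ?_, by simp only [map_mul, map_inv, inv_inv], ?_⟩
  · rw [Units.val_mul, Units.val_mul, mul_assoc, hAP, ← mul_assoc, Units.inv_mul, one_mul]
  · rw [← map_inv, ← map_mul, ← map_mul, inv_inv, proj_eq_proj_iff]
    refine ⟨Units.mk0 ε hε, ?_⟩
    rw [mul_assoc, inv_mul_eq_iff_eq_mul]
    apply Units.ext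
    rw [Units.val_mul, hBP, ← mul_assoc, ← GeneralLinearGroup.scalar_commute, mul_assoc,
      Units.val_mul, Units.val_mul, GeneralLinearGroup.coe_scalar, hS, Matrix.scalar_apply,
      Units.val_mk0, ← Matrix.smul_eq_diagonal_mul]

/-- Two matrices `diag(1, μ, μ⁻¹)` and `diag(1, ν, ν⁻¹)` with `μ`, `ν` primitive roots of unity of
the same order are powers of each other. -/
lemma mem_zpowers_of_isPrimitiveRoot {n : ℕ} [NeZero n] {μ ν : ℂ} (hμ : IsPrimitiveRoot μ n)
    (hν : IsPrimitiveRoot ν n) {D E : GL (Fin 3) ℂ}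
    (hD : (D : Matrix (Fin 3) (Fin 3) ℂ) = Matrix.diagonal ![1, μ, μ⁻¹])
    (hE : (E : Matrix (Fin 3) (Fin 3) ℂ) = Matrix.diagonal ![1, ν, ν⁻¹]) :
    E ∈ Subgroup.zpowers D := by
  obtain ⟨k, -, rfl⟩ := hμ.eq_pow_of_pow_eq_one hν.pow_eq_one
  refine ⟨k, Units.ext ?_⟩
  simp only [zpow_natCast]
  rw [Units.val_pow_eq_pow_val, hD, hE, Matrix.diagonal_pow]
  congr 1
  ext i
  fin_cases i <;> simp

lemma exists_dihedral_generators {G : Type*} [Group G] {n : ℕ} {H : Subgroup G}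
    (e : H ≃* DihedralGroup n) :
    ∃ a b : G, orderOf a = n ∧ a * b * a = b ∧ b * b = 1 ∧ H = Subgroup.closure {a, b} := by
  set f : DihedralGroup n →* G := H.subtype.comp e.symm.toMonoidHom with hf
  have hinj : Function.Injective f := H.subtype_injective.comp e.symm.injective
  have hrange : f.range = H := by
    rw [hf, MonoidHom.range_comp, MonoidHom.range_eq_top.2 e.symm.surjective,
      ← MonoidHom.range_eq_map, Subgroup.range_subtype]
  refine ⟨f (.r 1), f (.sr 0), ?_, ?_, ?_, ?_⟩
  · rw [orderOf_injective f hinj, DihedralGroup.orderOf_r_one]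
  · rw [← map_mul, ← map_mul]
    simp
  · rw [← map_mul, DihedralGroup.sr_mul_self, map_one]
  · have htop : Subgroup.closure {DihedralGroup.r (1 : ZMod n), .sr 0} = ⊤ := by
      rw [eq_top_iff]
      have hr : ∀ i : ZMod n, DihedralGroup.r i ∈
          Subgroup.closure {DihedralGroup.r (1 : ZMod n), .sr 0} := fun i => by
        obtain ⟨k, rfl⟩ := ZMod.intCast_surjective i
        rw [← DihedralGroup.r_one_zpow]
        exact zpow_mem (Subgroup.subset_closure (by simp)) k
      rintro (i | i) -
      · exact hr i
      · have := mul_mem (Subgroup.subset_closure (by simp) :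
          DihedralGroup.sr (0 : ZMod n) ∈ Subgroup.closure {.r (1 : ZMod n), .sr 0}) (hr i)
        simpa using this
    rw [← hrange, MonoidHom.range_eq_map, ← htop, MonoidHom.map_closure, Set.image_pair]

lemma exists_conj_map_eq_closure {n : ℕ} (hn : 3 ≤ n) {ζ : ℂ} (hζ : IsPrimitiveRoot ζ n)
    {G : Subgroup PGL3C} (e : G ≃* DihedralGroup n) {A B : GL (Fin 3) ℂ}
    (hA : (A : Matrix (Fin 3) (Fin 3) ℂ) = Matrix.diagonal ![1, ζ, ζ⁻¹])
    (hB : (B : Matrix (Fin 3) (Fin 3) ℂ) = !![1, 0, 0; 0, 0, 1; 0, 1, 0]) :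
    ∃ φ : PGL3C, Subgroup.map (MulAut.conj φ).toMonoidHom G =
      Subgroup.closure {proj A, proj B} := by
  have : NeZero n := ⟨by omega⟩
  obtain ⟨a, b, ha, hab, hb, rfl⟩ := exists_dihedral_generators e
  obtain ⟨φ, D, μ, hD, hφa, hφb⟩ := exists_conj_eq_standard (by omega) hab hb hB
  have hμ : IsPrimitiveRoot μ n := by
    have h := isPrimitiveRoot_orderOf_proj hD
    rwa [← hφa, ← MulAut.conj_apply, MulEquiv.orderOf_eq, ha] at h
  refine ⟨φ, ?_⟩
  rw [MonoidHom.map_closure, Set.image_pair]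
  simp only [MulEquiv.toMonoidHom_eq_coe, MonoidHom.coe_coe, MulAut.conj_apply, hφa, hφb]
  have key : ∀ {X Y : GL (Fin 3) ℂ}, X ∈ Subgroup.zpowers Y →
      Subgroup.closure {proj X, proj B} ≤ Subgroup.closure {proj Y, proj B} := by
    rintro _ Y ⟨k, rfl⟩
    rw [Subgroup.closure_le, Set.pair_subset_iff]
    refine ⟨?_, Subgroup.subset_closure (by simp)⟩
    simp only [map_zpow]
    exact zpow_mem (Subgroup.subset_closure (by simp)) k
  exact le_antisymm (key (mem_zpowers_of_isPrimitiveRoot hζ hμ hA hD))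
    (key (mem_zpowers_of_isPrimitiveRoot hμ hζ hD hA))

theorem stmt11 (n : ℕ) (hn : 3 ≤ n) :
    (∀ G₁ G₂ : Subgroup PGL3C,
        Nonempty (G₁ ≃* DihedralGroup n) → Nonempty (G₂ ≃* DihedralGroup n) →
        ∃ φ : PGL3C, Subgroup.map (MulAut.conj φ).toMonoidHom G₁ = G₂) ∧
      ∀ (G : Subgroup PGL3C), Nonempty (G ≃* DihedralGroup n) →
        ∀ A B : GL (Fin 3) ℂ,
          (A : Matrix (Fin 3) (Fin 3) ℂ)
            = Matrix.diagonal ![1, Complex.exp (2 * Real.pi * Complex.I / (n : ℂ)), (Complex.exp (2 * Real.pi * Complex.I / (n : ℂ)))⁻¹] →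
          (B : Matrix (Fin 3) (Fin 3) ℂ) = !![1, 0, 0; 0, 0, 1; 0, 1, 0] →
          ∃ φ : PGL3C,
            Subgroup.map (MulAut.conj φ).toMonoidHom G
              = Subgroup.closure {proj A, proj B} := by
  have hζ := Complex.isPrimitiveRoot_exp n (by omega)
  have hstd := fun (G : Subgroup PGL3C) (e : G ≃* DihedralGroup n) (A B : GL (Fin 3) ℂ) =>
    exists_conj_map_eq_closure hn hζ e (A := A) (B := B)
  refine ⟨?_, fun G ⟨e⟩ A B => hstd G e A B⟩
  rintro G₁ G₂ ⟨e₁⟩ ⟨e₂⟩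
  obtain ⟨A, hA⟩ : IsUnit (Matrix.diagonal ![1, Complex.exp (2 * Real.pi * Complex.I / (n : ℂ)),
      (Complex.exp (2 * Real.pi * Complex.I / (n : ℂ)))⁻¹]) := by
    rw [Matrix.isUnit_iff_isUnit_det, Matrix.det_diagonal, Fin.prod_univ_three]
    simp
  obtain ⟨B, hB⟩ : IsUnit (!![1, 0, 0; 0, 0, 1; 0, 1, 0] : Matrix (Fin 3) (Fin 3) ℂ) := by
    rw [Matrix.isUnit_iff_isUnit_det, Matrix.det_fin_three]
    simp
  obtain ⟨φ₁, h₁⟩ := hstd G₁ e₁ A B hA hB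
  obtain ⟨φ₂, h₂⟩ := hstd G₂ e₂ A B hA hB
  refine ⟨φ₂⁻¹ * φ₁, ?_⟩
  have hinv : Subgroup.map (MulAut.conj φ₂⁻¹).toMonoidHom
      (Subgroup.map (MulAut.conj φ₂).toMonoidHom G₂) = G₂ := by
    rw [Subgroup.map_map]
    convert Subgroup.map_id G₂
    ext x
    simp
  rw [← hinv, h₂, ← h₁, Subgroup.map_map]
  congr 1
  ext x
  simp [mul_assoc]
end
end

section
/- The group ℤ/3ℤ × ℤ/3ℤ does not embed into PGL₃(ℝ). More generally, for a field K of characteristic 0, PGL₃(K) contains a subgroup isomorphic to C₃ × C₃ if and only if K contains a primitive cube root of unity. -/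
open Matrix

noncomputable section


abbrev PGL3 (K : Type) [Field K] := GL (Fin 3) K ⧸ Subgroup.center (GL (Fin 3) K)

theorem eq_of_pow_three_eq {K : Type*} [Field K] (hK : ¬∃ ζ : K, IsPrimitiveRoot ζ 3)
    {a b : K} (hb : b ≠ 0) (h : a ^ 3 = b ^ 3) : a = b := by
  by_contra hab
  refine hK ⟨a / b, IsPrimitiveRoot.iff_orderOf.mpr (orderOf_eq_prime ?_ ?_)⟩
  · rw [div_pow, h, div_self (pow_ne_zero 3 hb)]
  · rwa [Ne, div_eq_one_iff_eq hb]

theorem eq_one_of_mem_center_of_det_eq_one {K : Type*} [Field K]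
    (hK : ¬∃ ζ : K, IsPrimitiveRoot ζ 3) {z : GL (Fin 3) K}
    (hz : z ∈ Subgroup.center (GL (Fin 3) K)) (hdet : z.val.det = 1) : z = 1 := by
  obtain ⟨c, hc⟩ := GeneralLinearGroup.mem_center_iff_val_mem_range_scalar.mp hz
  have hc3 : c ^ 3 = 1 ^ 3 := by simpa [← hc] using hdet
  ext1
  rw [← hc, eq_of_pow_three_eq hK one_ne_zero hc3, map_one, Units.val_one]

theorem mul_comm_of_inv_mul_mem_center {K : Type*} [Field K]
    (hK : ¬∃ ζ : K, IsPrimitiveRoot ζ 3) {A B : GL (Fin 3) K}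
    (h : (A * B)⁻¹ * (B * A) ∈ Subgroup.center (GL (Fin 3) K)) : A * B = B * A := by
  refine inv_mul_eq_one.mp (eq_one_of_mem_center_of_det_eq_one hK h ?_)
  rw [← GeneralLinearGroup.val_det_apply, map_mul, map_inv, map_mul, map_mul,
    mul_comm (GeneralLinearGroup.det B), inv_mul_cancel, Units.val_one]

/-- The Cayley-Hamilton theorem in dimension three. -/
theorem exists_pow_three_eq {R : Type*} [CommRing R] (M : Matrix (Fin 3) (Fin 3) R) :
    ∃ s : R, M ^ 3 - M.trace • M ^ 2 + s • M = scalar (Fin 3) M.det := by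
  refine ⟨M.charpoly.coeff 1, ?_⟩
  nontriviality R
  have h := M.aeval_self_charpoly
  have hd : M.charpoly.natDegree = 3 := by simp [charpoly_natDegree_eq_dim]
  have h3 : M.charpoly.coeff 3 = 1 := by
    simpa [hd] using (charpoly_monic M).coeff_natDegree
  have h2 := trace_eq_neg_charpoly_coeff M
  have h0 := det_eq_sign_charpoly_coeff M
  rw [Polynomial.aeval_eq_sum_range, hd] at h
  simp only [Finset.sum_range_succ, Finset.sum_range_zero, h3, pow_zero, pow_one] at h
  simp only [Fintype.card_fin, Nat.add_one_sub_one] at h2 h0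
  rw [h2, h0, scalar_apply, ← smul_one_eq_diagonal, ← sub_eq_zero, ← h]
  module

/-- Over a field without primitive cube roots of unity, a nontrivial element of `PGL₃` of order
three lifts to matrices of trace zero. -/
theorem trace_eq_zero_of_pow_three_mem_center {K : Type*} [Field K]
    (hK : ¬∃ ζ : K, IsPrimitiveRoot ζ 3) {M : GL (Fin 3) K}
    (h3 : M ^ 3 ∈ Subgroup.center (GL (Fin 3) K))
    (hM : M ∉ Subgroup.center (GL (Fin 3) K)) : M.val.trace = 0 := by
  obtain ⟨m, hm⟩ := GeneralLinearGroup.mem_center_iff_val_mem_range_scalar.mp h3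
  rw [Units.val_pow_eq_pow_val] at hm
  have hmd : m = M.val.det :=
    eq_of_pow_three_eq hK M.det_ne_zero (by simpa using congrArg Matrix.det hm)
  obtain ⟨s, hs⟩ := exists_pow_three_eq M.val
  rw [← hmd, hm, sub_add, sub_eq_self, sub_eq_zero] at hs
  by_contra ht
  refine hM (GeneralLinearGroup.mem_center_iff_val_mem_range_scalar.mpr ⟨M.val.trace⁻¹ * s, ?_⟩)
  refine M.isUnit.mul_left_cancel ?_
  rw [← pow_two, ← inv_smul_smul₀ ht (M.val ^ 2), hs, smul_smul, scalar_apply,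
    ← smul_one_eq_diagonal]
  simp

theorem exists_isPrimitiveRoot_of_injective {K : Type} [Field K] [CharZero K]
    (f : Multiplicative (ZMod 3 × ZMod 3) →* PGL3 K) (hf : Function.Injective f) :
    ∃ ζ : K, IsPrimitiveRoot ζ 3 := by
  by_contra hK
  choose M hM using fun g => QuotientGroup.mk_surjective (f g)
  have hmem : ∀ A : GL (Fin 3) K, A ∈ Subgroup.center (GL (Fin 3) K) ↔ (A : PGL3 K) = 1 :=
    fun A => (QuotientGroup.eq_one_iff A).symm
  have hcomm : ∀ g h, M g * M h = M h * M g := fun g h =>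
    mul_comm_of_inv_mul_mem_center hK <| by
      rw [hmem]
      simp only [QuotientGroup.mk_mul, QuotientGroup.mk_inv, hM, ← map_mul, mul_comm h g]
      simp
  have htrace : ∀ g h, g ≠ h → ((M g).val * (M h)⁻¹.val).trace = 0 := by
    intro g h hgh
    have hc : ((M g * (M h)⁻¹ : GL (Fin 3) K) : PGL3 K) = f (g * h⁻¹) := by
      rw [QuotientGroup.mk_mul, QuotientGroup.mk_inv, hM, hM, map_mul, map_inv]
    rw [← Units.val_mul]
    apply trace_eq_zero_of_pow_three_mem_center hK
    · rw [hmem, QuotientGroup.mk_pow, hc, ← map_pow]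
      have : ∀ x : Multiplicative (ZMod 3 × ZMod 3), x ^ 3 = 1 := by decide
      rw [this, map_one]
    · rw [hmem, hc, map_eq_one_iff f hf, mul_inv_eq_one]
      exact hgh
  have hli : LinearIndependent K fun g => (M g).val := by
    rw [Fintype.linearIndependent_iff]
    intro c hc h
    have := congrArg (fun X => (X * (M h)⁻¹.val).trace) hc
    simp only [Finset.sum_mul, trace_sum, smul_mul_assoc, trace_smul, zero_mul, trace_zero] at this
    rw [Finset.sum_eq_single h (fun g _ hg => by rw [htrace g h hg, smul_zero]) (by simp)] at this
    rw [← Units.val_mul] at this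
    simpa using this
  have hspan := hli.span_eq_top_of_card_eq_finrank' (by
    simp [Module.finrank_matrix])
  have hcenter : ∀ g, M g ∈ Subgroup.center (GL (Fin 3) K) := by
    intro g
    rw [Subgroup.mem_center_iff]
    intro A
    ext1
    have hA : A.val ∈ Submodule.span K (Set.range fun g => (M g).val) := hspan ▸ Submodule.mem_top
    rw [Units.val_mul, Units.val_mul]
    generalize A.val = X at hA
    induction hA using Submodule.span_induction with
    | mem X hX =>
      obtain ⟨h, rfl⟩ := hX
      exact congrArg Units.val (hcomm h g)
    | zero => simp
    | add X Y _ _ hX hY => rw [add_mul, mul_add, hX, hY]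
    | smul a X _ hX => rw [smul_mul_assoc, mul_smul_comm, hX]
  have htriv : ∀ g : Multiplicative (ZMod 3 × ZMod 3), g = 1 := fun g => by
    rw [← map_eq_one_iff f hf, ← hM, ← hmem]
    exact hcenter g
  exact absurd (htriv (Multiplicative.ofAdd (1, 0))) (by decide)

theorem exists_injective_of_isPrimitiveRoot {K : Type} [Field K] {ζ : K}
    (hζ : IsPrimitiveRoot ζ 3) :
    ∃ f : Multiplicative (ZMod 3 × ZMod 3) →* PGL3 K, Function.Injective f := by
  have hu : IsPrimitiveRoot (hζ.isUnit three_ne_zero).unit 3 := hζ.isUnit_unit three_ne_zero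
  set u := (hζ.isUnit three_ne_zero).unit
  have hadd (a b : ZMod 3) : u ^ (a + b).val = u ^ a.val * u ^ b.val := by
    rw [ZMod.val_add, ← pow_add, ← pow_eq_pow_mod _ hu.pow_eq_one]
  have hone (a : ZMod 3) (ha : u ^ a.val = 1) : a = 0 := by
    rw [hu.pow_eq_one_iff_dvd] at ha
    exact (ZMod.val_eq_zero a).mp (Nat.eq_zero_of_dvd_of_lt ha a.val_lt)
  let δ : (Fin 3 → Kˣ) →* GL (Fin 3) K :=
    (Units.map (diagonalRingHom (Fin 3) K).toMonoidHom).comp MulEquiv.piUnits.symm.toMonoidHom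
  let χ : Multiplicative (ZMod 3 × ZMod 3) →* (Fin 3 → Kˣ) :=
    MonoidHom.mk' (fun g => ![1, u ^ g.toAdd.1.val, u ^ g.toAdd.2.val]) fun g h => by
      ext i; fin_cases i <;> simp [hadd]
  refine ⟨(QuotientGroup.mk' _).comp (δ.comp χ), (injective_iff_map_eq_one _).mpr fun g hg => ?_⟩
  obtain ⟨c, hc⟩ := GeneralLinearGroup.mem_center_iff_val_mem_range_scalar.mp
    ((QuotientGroup.eq_one_iff _).mp hg)
  have hdiag (i : Fin 3) : c = (χ g i : K) := by
    simpa [δ] using congrFun (congrFun hc i) i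
  have hc1 : c = 1 := hdiag 0
  have h1 := hone _ (Units.ext ((hdiag 1).symm.trans hc1))
  have h2 := hone _ (Units.ext ((hdiag 2).symm.trans hc1))
  exact Prod.ext h1 h2

theorem Real.not_isPrimitiveRoot_three (ζ : ℝ) : ¬IsPrimitiveRoot ζ 3 := fun h =>
  h.ne_one (by norm_num) ((pow_eq_one_iff_of_ne_zero three_ne_zero).mp h.pow_eq_one |>.resolve_right
    fun h => absurd h.2 (by decide))

theorem stmt12 :
    (∀ (K : Type) [Field K] [CharZero K],
        (∃ f : Multiplicative (ZMod 3 × ZMod 3) →* PGL3 K, Function.Injective f)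
          ↔ ∃ ζ : K, IsPrimitiveRoot ζ 3) ∧
      ¬∃ f : Multiplicative (ZMod 3 × ZMod 3) →* PGL3 ℝ, Function.Injective f :=
  ⟨fun _ _ _ => ⟨fun ⟨f, hf⟩ => exists_isPrimitiveRoot_of_injective f hf,
      fun ⟨_, hζ⟩ => exists_injective_of_isPrimitiveRoot hζ⟩,
    fun ⟨f, hf⟩ => (exists_isPrimitiveRoot_of_injective f hf).elim Real.not_isPrimitiveRoot_three⟩
end
end

section
/- The Klein group PSL(2,7) realized as a subgroup of PGL₃(ℂ) is not conjugate in PGL₃(ℂ) to a subgroup of PGL₃(ℝ): any such subgroup contains an element conjugate to the image of diag(1, ζ₇, ζ₇³), and the cyclic group generated by diag(1, ζ₇, ζ₇³) is not definable over ℝ since none of 1+3, 1−6, 2−3 is divisible by 7. -/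
open Matrix

noncomputable section

/-- In `PSL(2, 7)` there is an element of order `7` conjugate to its square. -/
lemma exists_psl_conj_eq_sq :
    ∃ x t : Matrix.ProjectiveSpecialLinearGroup (Fin 2) (ZMod 7),
      x ≠ 1 ∧ x ^ 7 = 1 ∧ t * x * t⁻¹ = x ^ 2 := by
  let u : SpecialLinearGroup (Fin 2) (ZMod 7) := ⟨!![1, 1; 0, 1], by decide⟩
  let l : SpecialLinearGroup (Fin 2) (ZMod 7) := ⟨!![1, 0; 1, 1], by decide⟩
  let d : SpecialLinearGroup (Fin 2) (ZMod 7) := ⟨!![3, 0; 0, 5], by decide⟩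
  have hu7 : u ^ 7 = 1 := by
    apply Subtype.ext
    change (!![1, 1; 0, 1] : Matrix (Fin 2) (Fin 2) (ZMod 7)) ^ 7 = 1
    decide
  have hdu : d * u = u ^ 2 * d := by
    apply Subtype.ext
    change (!![3, 0; 0, 5] * !![1, 1; 0, 1] : Matrix (Fin 2) (Fin 2) (ZMod 7))
      = !![1, 1; 0, 1] ^ 2 * !![3, 0; 0, 5]
    decide
  have hlu : l * u ≠ u * l := by
    intro h
    have h00 := congrArg (fun g : SpecialLinearGroup (Fin 2) (ZMod 7) => g.1 0 0) h
    revert h00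
    decide
  refine ⟨QuotientGroup.mk' _ u, QuotientGroup.mk' _ d, fun h => hlu ?_, ?_, ?_⟩
  · rw [QuotientGroup.mk'_apply, QuotientGroup.eq_one_iff, Subgroup.mem_center_iff] at h
    exact h l
  · rw [← map_pow, hu7, map_one]
  · rw [mul_inv_eq_iff_eq_mul, ← map_mul, ← map_pow, ← map_mul, hdu]

/-- A pair `x, t` with `x ^ n = 1` and `t * x * t⁻¹ = x ^ 2` in a central quotient lifts to such
a pair in the group itself. -/
lemma exists_lift_conj_eq_sq {G : Type*} [Group G] {n : ℕ} {x t : G ⧸ Subgroup.center G}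
    (hx : x ^ n = 1) (ht : t * x * t⁻¹ = x ^ 2) :
    ∃ X T : G, QuotientGroup.mk' (Subgroup.center G) X = x ∧ X ^ n = 1 ∧
      T * X * T⁻¹ = X ^ 2 := by
  obtain ⟨X, rfl⟩ := QuotientGroup.mk'_surjective _ x
  obtain ⟨T, rfl⟩ := QuotientGroup.mk'_surjective _ t
  rw [← map_mul, ← map_inv, ← map_mul, ← map_pow, QuotientGroup.mk'_eq_mk'] at ht
  obtain ⟨z, hz, h⟩ := ht
  have hz' : ∀ g, Commute g z⁻¹ :=
    fun g => Subgroup.mem_center_iff.mp (Subgroup.inv_mem _ hz) g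
  have hconj : T * (X * z⁻¹) * T⁻¹ = (X * z⁻¹) ^ 2 := by
    rw [(hz' X).mul_pow, ← h, ← mul_assoc, mul_assoc, (hz' T⁻¹).eq.symm]
    simp only [mul_assoc, pow_two]
    simp
  have hmk : QuotientGroup.mk' (Subgroup.center G) (X * z⁻¹) = QuotientGroup.mk' _ X :=
    (QuotientGroup.mk'_eq_mk' _).2 ⟨z, hz, by simp⟩
  refine ⟨X * z⁻¹, T, hmk, ?_, hconj⟩
  have hc : (X * z⁻¹) ^ n ∈ Subgroup.center G := by
    rw [← hmk, ← map_pow] at hx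
    exact (QuotientGroup.eq_one_iff _).1 hx
  have key : (X * z⁻¹) ^ n = (X * z⁻¹) ^ n * (X * z⁻¹) ^ n := by
    conv_lhs => rw [← mul_inv_cancel_right ((X * z⁻¹) ^ n) T]
    rw [← Subgroup.mem_center_iff.mp hc T, ← conj_pow, hconj, ← pow_mul, ← pow_add, two_mul]
  exact left_eq_mul.mp key

/-- A matrix `X ≠ 1` with `X ^ n = 1` has an eigenvalue `μ ≠ 1` with `μ ^ n = 1`. -/
lemma exists_eigenvector_of_pow_eq_one {K ι : Type*} [Field K] [IsAlgClosed K] [Fintype ι]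
    [DecidableEq ι] [Nonempty ι] {n : ℕ} (hn : (n : K) ≠ 0) {X : Matrix ι ι K}
    (hX : X ^ n = 1) (hX1 : X ≠ 1) :
    ∃ μ : K, μ ^ n = 1 ∧ μ ≠ 1 ∧ ∃ v : ι → K, v ≠ 0 ∧ X *ᵥ v = μ • v := by
  let p : Polynomial K := ∑ i ∈ Finset.range n, Polynomial.X ^ i
  have hq : ¬IsUnit (Polynomial.aeval X p) := by
    intro h
    apply hX1
    have h0 : (X - 1) * Polynomial.aeval X p = 0 := by
      simp [p, mul_geom_sum, hX]
    exact sub_eq_zero.mp ((h.mul_left_eq_zero).mp h0)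
  have h0 : (0 : K) ∈ spectrum K (Polynomial.aeval X p) := (spectrum.zero_mem_iff K).2 hq
  rw [spectrum.map_polynomial_aeval_of_nonempty X p
    (spectrum.nonempty_of_isAlgClosed_of_finiteDimensional K X)] at h0
  obtain ⟨μ, hμ, hpμ⟩ := h0
  have hsum : ∑ i ∈ Finset.range n, μ ^ i = 0 := by
    simpa [p, Polynomial.eval_finsetSum] using hpμ
  refine ⟨μ, ?_, ?_, ?_⟩
  · rw [← sub_eq_zero, ← geom_sum_mul, hsum, zero_mul]
  · rintro rfl
    exact hn (by simpa using hsum)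
  · rw [spectrum.mem_iff, Matrix.isUnit_iff_isUnit_det, isUnit_iff_ne_zero, not_not,
      ← Matrix.exists_mulVec_eq_zero_iff] at hμ
    obtain ⟨v, hv, h⟩ := hμ
    refine ⟨v, hv, ?_⟩
    rw [Matrix.sub_mulVec, sub_eq_zero, Algebra.algebraMap_eq_smul_one, Matrix.smul_mulVec,
      Matrix.one_mulVec] at h
    exact h.symm

/-- A matrix with eigenvectors for pairwise distinct eigenvalues `d i` is conjugate to
`diagonal d`. -/
lemma exists_mul_eq_mul_diagonal {K ι : Type*} [Field K] [Fintype ι] [DecidableEq ι]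
    {Y : Matrix ι ι K} {d : ι → K} (hd : Function.Injective d) (v : ι → ι → K)
    (hv : ∀ i, v i ≠ 0) (hY : ∀ i, Y *ᵥ v i = d i • v i) :
    ∃ P : GL ι K, Y * (P : Matrix ι ι K) = P * Matrix.diagonal d := by
  have hli : LinearIndependent K v :=
    Module.End.eigenvectors_linearIndependent' (Matrix.toLin' Y) d hd v fun i =>
      Module.End.hasEigenvector_iff.2
        ⟨Module.End.mem_eigenspace_iff.2 (by simpa using hY i), hv i⟩
  have hu : IsUnit (Matrix.of v)ᵀ :=
    Matrix.linearIndependent_cols_iff_isUnit.1 hli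
  refine ⟨hu.unit, ?_⟩
  ext i j
  rw [IsUnit.unit_spec, Matrix.mul_diagonal]
  have := congrFun (hY j) i
  simpa [Matrix.mul_apply, Matrix.mulVec, dotProduct, mul_comm] using this

lemma pow_mulVec_of_eigenvector {K ι : Type*} [CommRing K] [Fintype ι] [DecidableEq ι]
    {X : Matrix ι ι K} {μ : K} {v : ι → K} (h : X *ᵥ v = μ • v) (m : ℕ) :
    (X ^ m) *ᵥ v = μ ^ m • v := by
  induction m with
  | zero => simp
  | succ m ih => rw [pow_succ, ← Matrix.mulVec_mulVec, h, Matrix.mulVec_smul, ih, smul_smul,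
      pow_succ']

lemma IsPrimitiveRoot.of_pow_eq_one_of_prime {M : Type*} [CommMonoid M] {p : ℕ} {μ : M}
    (hp : p.Prime) (h : μ ^ p = 1) (h1 : μ ≠ 1) : IsPrimitiveRoot μ p := by
  have : Fact p.Prime := ⟨hp⟩
  exact IsPrimitiveRoot.iff_orderOf.2 (orderOf_eq_prime h h1)

/-- An element of `GL₃(ℂ)` of order `7` that is conjugate to its square has a power conjugate to
`diag(ζ, ζ², ζ⁴)`, for every primitive seventh root of unity `ζ`. -/
lemma exists_pow_conj_diagonal {ζ : ℂ} (hζ : IsPrimitiveRoot ζ 7) {X T : GL (Fin 3) ℂ}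
    (hX : X ^ 7 = 1) (hX1 : X ≠ 1) (hT : T * X * T⁻¹ = X ^ 2) :
    ∃ (m : ℕ) (P : GL (Fin 3) ℂ), ((X ^ m : GL (Fin 3) ℂ) : Matrix (Fin 3) (Fin 3) ℂ) * P.1
      = P.1 * Matrix.diagonal ![ζ, ζ ^ 2, ζ ^ 4] := by
  obtain ⟨μ, hμ, hμ1, v, hv, hXv⟩ := exists_eigenvector_of_pow_eq_one (n := 7)
    (X := (X : Matrix (Fin 3) (Fin 3) ℂ)) (by norm_num)
    (by rw [← Units.val_pow_eq_pow_val, hX, Units.val_one]) (by simpa using hX1)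
  obtain ⟨m, -, hm⟩ :=
    (IsPrimitiveRoot.of_pow_eq_one_of_prime (by norm_num) hμ hμ1).eq_pow_of_pow_eq_one
      hζ.pow_eq_one
  have hYv : ((X ^ m : GL (Fin 3) ℂ) : Matrix (Fin 3) (Fin 3) ℂ) *ᵥ v = ζ • v := by
    rw [← hm, Units.val_pow_eq_pow_val]
    exact pow_mulVec_of_eigenvector hXv m
  have hTY : T * X ^ m * T⁻¹ = (X ^ m) ^ 2 := by
    rw [← conj_pow, hT, ← pow_mul, ← pow_mul, mul_comm]
  have hstep : ∀ {w : Fin 3 → ℂ} {a : ℂ}, (X ^ m : GL (Fin 3) ℂ).1 *ᵥ w = a • w →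
      (X ^ m : GL (Fin 3) ℂ).1 *ᵥ (T⁻¹.1 *ᵥ w) = a ^ 2 • (T⁻¹.1 *ᵥ w) := by
    intro w a hw
    have hcomm : X ^ m * T⁻¹ = T⁻¹ * (X ^ m) ^ 2 := by rw [← hTY]; group
    rw [Matrix.mulVec_mulVec, ← Units.val_mul, hcomm, Units.val_mul, ← Matrix.mulVec_mulVec,
      Units.val_pow_eq_pow_val, pow_mulVec_of_eigenvector hw, Matrix.mulVec_smul]
  have hne : ∀ {w : Fin 3 → ℂ}, w ≠ 0 → T⁻¹.1 *ᵥ w ≠ 0 := by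
    intro w hw h
    apply hw
    have := congrArg (T.1 *ᵥ ·) h
    simpa only [Matrix.mulVec_mulVec, Units.mul_inv, Matrix.one_mulVec, Matrix.mulVec_zero]
      using this
  have hinj : Function.Injective ![ζ, ζ ^ 2, ζ ^ 4] := by
    have h : ![ζ, ζ ^ 2, ζ ^ 4] = fun i => ζ ^ (![1, 2, 4] i : ℕ) := by
      ext i; fin_cases i <;> simp
    rw [h]
    intro i j hij
    have := hζ.pow_inj (by fin_cases i <;> decide) (by fin_cases j <;> decide) hij
    revert this
    fin_cases i <;> fin_cases j <;> simp
  obtain ⟨P, hP⟩ := exists_mul_eq_mul_diagonal hinj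
    ![v, T⁻¹.1 *ᵥ v, T⁻¹.1 *ᵥ (T⁻¹.1 *ᵥ v)] (Y := (X ^ m : GL (Fin 3) ℂ).1)
    (by
      intro i
      fin_cases i
      exacts [hv, hne hv, hne (hne hv)])
    (by
      have h4 := hstep (hstep hYv)
      rw [← pow_mul] at h4
      intro i
      fin_cases i
      exacts [hYv, hstep hYv, h4])
  exact ⟨m, P, hP⟩

/-- If the class of `A` is conjugate into `PGL₃(ℝ)`, then `(tr A)³ / det A` is real. -/
lemma exists_real_trace_pow_three_eq {A : GL (Fin 3) ℂ} {φ : PGL3C}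
    (h : φ * proj A * φ⁻¹ ∈ PGL3R) :
    ∃ r : ℝ, Matrix.trace A.1 ^ 3 = r * Matrix.det A.1 := by
  obtain ⟨F, rfl⟩ := QuotientGroup.mk'_surjective _ φ
  obtain ⟨_, ⟨R, rfl⟩, hR⟩ := h
  change proj _ = proj F * proj A * (proj F)⁻¹ at hR
  rw [← map_inv, ← map_mul, ← map_mul] at hR
  obtain ⟨z, hz, hRz⟩ := (QuotientGroup.mk'_eq_mk' _).1 hR
  obtain ⟨c, hc⟩ := Matrix.GeneralLinearGroup.mem_center_iff_val_mem_range_scalar.1 hz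
  have hM : (R.1.map (algebraMap ℝ ℂ)) * Matrix.scalar (Fin 3) c = F.1 * A.1 * F⁻¹.1 := by
    rw [hc]
    exact congrArg Units.val hRz
  have htr : Matrix.trace A.1 = Matrix.trace R.1 * c := by
    have := congrArg Matrix.trace hM
    rw [Matrix.trace_mul_cycle, Units.inv_mul, one_mul] at this
    rw [← this]
    simp [Matrix.trace, add_mul, Fin.sum_univ_three]
  have hdet : Matrix.det A.1 = Matrix.det R.1 * c ^ 3 := by
    have := congrArg Matrix.det hM
    rw [Matrix.det_mul_right_comm, Units.mul_inv, one_mul] at this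
    rw [← this, Matrix.det_mul, ← RingHom.mapMatrix_apply, ← RingHom.map_det]
    simp
  have hR0 : ((Matrix.det R.1 : ℝ) : ℂ) ≠ 0 := by
    exact_mod_cast ((Matrix.isUnit_iff_isUnit_det _).1 R.isUnit).ne_zero
  refine ⟨Matrix.trace R.1 ^ 3 / Matrix.det R.1, ?_⟩
  rw [htr, hdet]
  push_cast
  field_simp

/-- `(1 + ζ + ζ³)³ / ζ⁴` is not real when `ζ` is a primitive seventh root of unity. -/
lemma pow_three_ne_real_mul {ζ : ℂ} (hζ : IsPrimitiveRoot ζ 7) (r : ℝ) :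
    (1 + ζ + ζ ^ 3) ^ 3 ≠ r * ζ ^ 4 := by
  intro h
  have h7 : ζ ^ 7 = 1 := hζ.pow_eq_one
  have hζ0 : ζ ≠ 0 := hζ.ne_zero (by norm_num)
  have hsum : 1 + ζ + ζ ^ 2 + ζ ^ 3 + ζ ^ 4 + ζ ^ 5 + ζ ^ 6 = 0 := by
    simpa [Finset.sum_range_succ] using hζ.geom_sum_eq_zero (by norm_num)
  have hr : ζ + ζ ^ 2 + ζ ^ 4 = ((2 - r : ℝ) : ℂ) := by
    apply mul_left_cancel₀ (pow_ne_zero 4 hζ0)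
    push_cast
    linear_combination -h + (ζ ^ 3 + 2 * ζ + 1) * hsum
  have hconj : (starRingEnd ℂ) ζ = ζ ^ 6 := by
    rw [← Complex.inv_eq_conj (hζ.norm'_eq_one (by norm_num))]
    exact inv_eq_of_mul_eq_one_right (by rw [← pow_succ', h7])
  have hc := congrArg (starRingEnd ℂ) hr
  rw [Complex.conj_ofReal, ← hr] at hc
  simp only [map_add, map_pow, hconj] at hc
  have hhalf : 2 * (ζ + ζ ^ 2 + ζ ^ 4) + 1 = 0 := by
    linear_combination -hc +
      (ζ ^ 18 - ζ ^ 17 + ζ ^ 11 - ζ ^ 10 + ζ ^ 6 - ζ ^ 5 + ζ ^ 4 - ζ ^ 3 + 1) * hsum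
  have hquad : (ζ + ζ ^ 2 + ζ ^ 4) ^ 2 + (ζ + ζ ^ 2 + ζ ^ 4) + 2 = 0 := by
    linear_combination (ζ ^ 2 - ζ + 2) * hsum
  have : (7 : ℂ) = 0 := by
    linear_combination 4 * hquad - (2 * (ζ + ζ ^ 2 + ζ ^ 4) + 1) * hhalf
  norm_num at this

theorem stmt17 (G : Subgroup PGL3C)
    (hG : Nonempty (G ≃* Matrix.ProjectiveSpecialLinearGroup (Fin 2) (ZMod 7))) :
    (∃ A : GL (Fin 3) ℂ,
        (A : Matrix (Fin 3) (Fin 3) ℂ)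
          = Matrix.diagonal ![1, Complex.exp (2 * Real.pi * Complex.I / 7), (Complex.exp (2 * Real.pi * Complex.I / 7)) ^ 3] ∧
        ∃ ψ : PGL3C, ψ⁻¹ * proj A * ψ ∈ G) ∧
      (∀ A : GL (Fin 3) ℂ,
        (A : Matrix (Fin 3) (Fin 3) ℂ)
          = Matrix.diagonal ![1, Complex.exp (2 * Real.pi * Complex.I / 7), (Complex.exp (2 * Real.pi * Complex.I / 7)) ^ 3] →
        ¬∃ φ : PGL3C,
          Subgroup.map (MulAut.conj φ).toMonoidHom (Subgroup.closure {proj A}) ≤ PGL3R) ∧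
      ¬∃ φ : PGL3C, Subgroup.map (MulAut.conj φ).toMonoidHom G ≤ PGL3R := by
  set ζ : ℂ := Complex.exp (2 * Real.pi * Complex.I / 7)
  have hζ : IsPrimitiveRoot ζ 7 := by
    simpa using Complex.isPrimitiveRoot_exp 7 (by norm_num)
  have hζ0 : ζ ≠ 0 := hζ.ne_zero (by norm_num)
  have hexists : ∃ A : GL (Fin 3) ℂ,
      (A : Matrix (Fin 3) (Fin 3) ℂ) = Matrix.diagonal ![1, ζ, ζ ^ 3] ∧
        ∃ ψ : PGL3C, ψ⁻¹ * proj A * ψ ∈ G := by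
    obtain ⟨e⟩ := hG
    obtain ⟨x, t, hx1, hx7, hxt⟩ := exists_psl_conj_eq_sq
    obtain ⟨X, T, hX, hX7, hXT⟩ := exists_lift_conj_eq_sq
      (x := (e.symm x : PGL3C)) (t := (e.symm t : PGL3C)) (n := 7)
      (by rw [← Subgroup.coe_pow, ← map_pow, hx7, map_one, Subgroup.coe_one])
      (by rw [← Subgroup.coe_pow, ← map_pow, ← hxt]; simp)
    have hX1 : X ≠ 1 := by
      rintro rfl
      rw [map_one] at hX
      exact hx1 (by simpa using hX.symm)
    obtain ⟨m, P, hP⟩ := exists_pow_conj_diagonal hζ hX7 hX1 hXT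
    let A : GL (Fin 3) ℂ := Matrix.GeneralLinearGroup.mkOfDetNeZero
      (Matrix.diagonal ![1, ζ, ζ ^ 3]) (by simp [Fin.prod_univ_three, hζ0])
    refine ⟨A, rfl, (proj P)⁻¹, ?_⟩
    have hA : A * Matrix.GeneralLinearGroup.scalar (Fin 3) (Units.mk0 ζ hζ0)
        = P⁻¹ * X ^ m * P := by
      rw [mul_assoc, eq_inv_mul_iff_mul_eq]
      ext1
      rw [Units.val_mul (X ^ m), hP, Units.val_mul, Units.val_mul]
      congr 1
      change Matrix.diagonal ![1, ζ, ζ ^ 3] * Matrix.scalar (Fin 3) ζ = _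
      rw [Matrix.scalar_apply, Matrix.diagonal_mul_diagonal]
      congr 1
      ext i
      fin_cases i <;> simp <;> ring
    have hpA : proj A = (proj P)⁻¹ * proj X ^ m * proj P := by
      rw [← map_inv, ← map_pow, ← map_mul, ← map_mul]
      refine (QuotientGroup.mk'_eq_mk' _).2 ⟨_, ?_, hA⟩
      rw [Matrix.GeneralLinearGroup.center_eq_range_scalar]
      exact ⟨_, rfl⟩
    have hXG : proj X ∈ G := by
      change QuotientGroup.mk' _ X ∈ G
      rw [hX]
      exact (e.symm x).2
    rw [hpA]
    convert pow_mem hXG m using 1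
    group
  have hnot : ∀ A : GL (Fin 3) ℂ,
      (A : Matrix (Fin 3) (Fin 3) ℂ) = Matrix.diagonal ![1, ζ, ζ ^ 3] →
        ∀ φ : PGL3C, φ * proj A * φ⁻¹ ∉ PGL3R := by
    intro A hA φ h
    obtain ⟨r, hr⟩ := exists_real_trace_pow_three_eq h
    apply pow_three_ne_real_mul hζ r
    rw [hA] at hr
    convert hr using 1
    · simp [Matrix.trace, Fin.sum_univ_three]
    · rw [Matrix.det_diagonal]
      simp only [Fin.prod_univ_three, Matrix.cons_val]
      ring
  refine ⟨hexists, ?_, ?_⟩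
  · rintro A hA ⟨φ, hφ⟩
    exact hnot A hA φ (hφ ⟨proj A, Subgroup.subset_closure rfl, rfl⟩)
  · rintro ⟨φ, hφ⟩
    obtain ⟨A, hA, ψ, hψ⟩ := hexists
    refine hnot A hA (φ * ψ⁻¹) ?_
    convert hφ ⟨_, hψ, rfl⟩ using 1
    simp [mul_assoc]
end
end
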